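/- Let S be a non-abelian finite simple group, m ≥ 1, and let G be a finite QSI group containing N = S^m as a normal subgroup with trivial centralizer C_G(N) = 1 (so that, identifying G with a subgroup of Aut(N), we have S^m ≤ G ≤ Aut(S^m)). If χ is an irreducible complex character of S that is invariant under every automorphism of S (i.e. χ ∘ α = χ for all α ∈ Aut(S)), then χ is QSI as a character of S: there exist a subgroup U ≤ S, φ ∈ Irr(U) with U/ker(φ) solvable, and a positive integer k with k·χ = φ^S. -/

import Mathlib

open scoped BigOperators Classical

noncomputable section

/-- `χ` is the character of some finite-dimensional complex representation of `G`. -/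
def IsCharacter (G : Type) [Monoid G] (χ : G → ℂ) : Prop :=
  ∃ V : FDRep ℂ G, χ = V.character

/-- `χ` is an irreducible complex character of `G`, i.e. the character of a simple
finite-dimensional complex representation of `G`. -/
def IsIrreducibleCharacter (G : Type) [Monoid G] (χ : G → ℂ) : Prop :=
  ∃ V : FDRep ℂ G, CategoryTheory.Simple V ∧ χ = V.character

/-- The class function of `G` induced from the function `φ` on the subgroup `U`:
`φ^G(g) = |U|⁻¹ · ∑_{y ∈ G, y⁻¹gy ∈ U} φ(y⁻¹gy)`. -/
def inducedChar {G : Type} [Group G] [Finite G] (U : Subgroup G) (φ : ↥U → ℂ) : G → ℂ :=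
  fun g => (Nat.card ↥U : ℂ)⁻¹ *
    ∑ᶠ y : G, if h : y⁻¹ * g * y ∈ U then φ ⟨y⁻¹ * g * y, h⟩ else 0

/-- `χ` is quasi solvably induced (QSI) from the subgroup `U` and `φ ∈ Irr(U)`:
there is `k ≥ 1` with `k·χ = φ^G`, and `U/ker(φ)` is solvable, where
`ker(φ) = {u ∈ U | φ(u) = φ(1)}`. -/
def IsQSIFrom {G : Type} [Group G] [Finite G] (χ : G → ℂ) (U : Subgroup G)
    (φ : ↥U → ℂ) : Prop :=
  IsIrreducibleCharacter ↥U φ ∧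
  (∃ k : ℕ, 0 < k ∧ ∀ g : G, (k : ℂ) * χ g = inducedChar U φ g) ∧
  ∃ (K : Subgroup ↥U) (hK : K.Normal), (K : Set ↥U) = {u : ↥U | φ u = φ 1} ∧
    (letI := hK; IsSolvable (↥U ⧸ K))

/-- `χ` is QSI from some subgroup `U ≤ G` and some `φ ∈ Irr(U)`. -/
def IsQSI {G : Type} [Group G] [Finite G] (χ : G → ℂ) : Prop :=
  ∃ (U : Subgroup G) (φ : ↥U → ℂ), IsQSIFrom χ U φ

/-- A finite group `G` is QSI if every irreducible complex character of `G` is QSI. -/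
def IsQSIGroup (G : Type) [Group G] [Finite G] : Prop :=
  ∀ χ : G → ℂ, IsIrreducibleCharacter G χ → IsQSI χ

/-- The usual inner product of class functions on a finite group. -/
def charInner {H : Type} [Group H] [Finite H] (α β : H → ℂ) : ℂ :=
  (Nat.card H : ℂ)⁻¹ * ∑ᶠ h : H, α h * starRingEnd ℂ (β h)


section helpers
open Representation Module

theorem bridge_of {G : Type} [Group G] [Finite G] {V : Type} [AddCommGroup V] [Module ℂ V]
    [FiniteDimensional ℂ V] (ρ : Representation ℂ G V) (h : ρ.IsIrreducible) :
    IsIrreducibleCharacter G ρ.character := by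
  have : Fintype G := Fintype.ofFinite G
  refine ⟨FDRep.of ρ, ?_, rfl⟩
  rw [FDRep.simple_iff_char_is_norm_one]
  have : Invertible (Nat.card G : ℂ) := invertibleOfNonzero (NeZero.ne (Nat.card G : ℂ))
  have h2 := char_orthonormal ρ ρ
  rw [if_pos ⟨Representation.Equiv.refl ρ⟩, inv_mul_eq_one₀ (NeZero.ne (Nat.card G : ℂ))] at h2
  exact h2.symm

theorem sum_char_eq {G : Type} [Group G] [Fintype G] {V W : Type} [AddCommGroup V] [Module ℂ V]
    [FiniteDimensional ℂ V] [AddCommGroup W] [Module ℂ W]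
    [FiniteDimensional ℂ W] (ρ : Representation ℂ G V) (σ : Representation ℂ G W) :
    ∑ g : G, σ.character g * ρ.character g⁻¹ =
      (Nat.card G : ℂ) * (finrank ℂ (IntertwiningMap ρ σ) : ℂ) := by
  have : Invertible (Nat.card G : ℂ) := invertibleOfNonzero (NeZero.ne (Nat.card G : ℂ))
  rw [← card_inv_mul_sum_char_mul_char_eq_finrank, mul_inv_cancel_left₀ (NeZero.ne (Nat.card G : ℂ))]

theorem irred_of_finrank_one {G : Type} [Group G] [Finite G] {V : Type} [AddCommGroup V] [Module ℂ V]
    [FiniteDimensional ℂ V] (ρ : Representation ℂ G V)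
    (h : finrank ℂ (IntertwiningMap ρ ρ) = 1) : ρ.IsIrreducible := by
  have hnt : Nontrivial (IntertwiningMap ρ ρ) := Module.nontrivial_of_finrank_pos (R := ℂ) (by omega)
  have hV : Nontrivial V := by
    by_contra hV
    rw [not_nontrivial_iff_subsingleton] at hV
    obtain ⟨f, g, hfg⟩ := hnt
    exact hfg (IntertwiningMap.ext (Subsingleton.elim _ _))
  rw [irreducible_iff_isSimpleModule_asModule]
  have : NeZero (Nat.card G : ℂ) := inferInstance
  have hss : IsSemisimpleModule (MonoidAlgebra ℂ G) ρ.asModule := inferInstance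
  have hV' : Nontrivial ρ.asModule := hV
  rw [isSimpleModule_iff]
  have : Nontrivial (Submodule (MonoidAlgebra ℂ G) ρ.asModule) := inferInstance
  refine ⟨fun p => ?_⟩
  obtain ⟨q, hpq⟩ := exists_isCompl p
  let π := p.subtype ∘ₗ Submodule.projectionOnto p q hpq
  let F : IntertwiningMap ρ ρ := (IntertwiningMap.equivLinearMapAsModule ρ ρ).symm π
  have hid : IntertwiningMap.id ρ ≠ 0 := by
    intro h0
    obtain ⟨v, hv⟩ := exists_ne (0 : V)
    exact hv (by simpa using congrArg (fun f : IntertwiningMap ρ ρ => f v) h0)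
  obtain ⟨c, hc⟩ := (finrank_eq_one_iff_of_nonzero' _ hid).mp h F
  have hπ : ∀ v : ρ.asModule, π v = c • v := by
    intro v
    have := congrArg (fun f : IntertwiningMap ρ ρ => (IntertwiningMap.equivLinearMapAsModule ρ ρ) f v) hc
    simp only [F, LinearEquiv.apply_symm_apply] at this
    exact this.symm
  by_cases hc0 : c = 0
  · left
    rw [eq_bot_iff]
    intro v hv
    have h1 := hπ v
    simp only [π, LinearMap.comp_apply] at h1
    have h2 := Submodule.projectionOnto_apply_left hpq ⟨v, hv⟩
    simp only at h2
    rw [h2, hc0] at h1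
    simpa using h1
  · right
    rw [eq_top_iff]
    intro v _
    have h1 : c • v ∈ p := by rw [← hπ v]; exact Submodule.coe_mem _
    have := p.smul_mem (algebraMap ℂ (MonoidAlgebra ℂ G) c⁻¹) h1
    rwa [algebraMap_smul, smul_smul, inv_mul_cancel₀ hc0, one_smul] at this

theorem bridge_to {G : Type} [Group G] [Finite G] {χ : G → ℂ} (h : IsIrreducibleCharacter G χ) :
    ∃ (V : Type) (_ : AddCommGroup V) (_ : Module ℂ V) (_ : FiniteDimensional ℂ V)
      (ρ : Representation ℂ G V), ρ.IsIrreducible ∧ χ = ρ.character := by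
  have : Fintype G := Fintype.ofFinite G
  obtain ⟨V, hV, rfl⟩ := h
  refine ⟨V, inferInstance, inferInstance, inferInstance, V.ρ, ?_, rfl⟩
  apply irred_of_finrank_one
  rw [FDRep.simple_iff_char_is_norm_one] at hV
  have h2 := sum_char_eq (V.ρ : Representation ℂ G V) V.ρ
  have h3 : ∑ g : G, Representation.character V.ρ g * Representation.character V.ρ g⁻¹ = Nat.card G := hV
  rw [h3] at h2
  have h4 := mul_left_cancel₀ (NeZero.ne (Nat.card G : ℂ)) ((mul_one _).trans h2)
  exact_mod_cast h4.symm

theorem exists_irred {G : Type} [Group G] {V : Type} [AddCommGroup V] [Module ℂ V]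
    [FiniteDimensional ℂ V] [Nontrivial V] (ρ : Representation ℂ G V) :
    ∃ W : Subrepresentation ρ, W.toRepresentation.IsIrreducible := by
  have hex : ∃ n, ∃ W : Subrepresentation ρ, W.toSubmodule ≠ ⊥ ∧ finrank ℂ W.toSubmodule = n :=
    ⟨_, ⊤, top_ne_bot, rfl⟩
  obtain ⟨W, hW, hWn⟩ := Nat.find_spec hex
  refine ⟨W, ?_⟩
  have key : ∀ X : Subrepresentation W.toRepresentation, X.toSubmodule = ⊥ ∨ X.toSubmodule = ⊤ := by
    intro X
    let Y : Subrepresentation ρ := ⟨X.toSubmodule.map W.toSubmodule.subtype, by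
      rintro g v ⟨x, hx, rfl⟩
      exact ⟨W.toRepresentation g x, X.apply_mem_toSubmodule g hx, rfl⟩⟩
    by_cases hX : X.toSubmodule = ⊥
    · exact Or.inl hX
    · right
      have hY : Y.toSubmodule ≠ ⊥ := by
        intro h
        exact hX (Submodule.map_injective_of_injective W.toSubmodule.injective_subtype
          (h.trans (Submodule.map_bot _).symm))
      have h1 := Nat.find_min' hex ⟨Y, hY, rfl⟩
      rw [← hWn] at h1
      have h2 : finrank ℂ Y.toSubmodule = finrank ℂ X.toSubmodule :=
        LinearEquiv.finrank_eq (Submodule.equivMapOfInjective _ W.toSubmodule.injective_subtype _).symm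
      apply Submodule.eq_top_of_finrank_eq
      apply le_antisymm (Submodule.finrank_le _)
      omega
  have hnt : Nontrivial (Subrepresentation W.toRepresentation) := by
    refine ⟨⊥, ⊤, fun h => hW ?_⟩
    have h2 : (⊥ : Submodule ℂ W.toSubmodule) = ⊤ := congrArg Subrepresentation.toSubmodule h
    have := (Submodule.subsingleton_iff ℂ).mp (subsingleton_of_bot_eq_top h2)
    exact Submodule.eq_bot_of_subsingleton
  exact ⟨fun X => (key X).imp (fun h => Subrepresentation.toSubmodule_injective h)
    (fun h => Subrepresentation.toSubmodule_injective h)⟩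

/-- sum of `f g • ρ g`. -/
def classOp {G : Type} [Group G] [Fintype G] {V : Type} [AddCommGroup V] [Module ℂ V]
    (ρ : Representation ℂ G V) (f : G → ℂ) : V →ₗ[ℂ] V := ∑ g : G, f g • ρ g

theorem classOp_apply {G : Type} [Group G] [Fintype G] {V : Type} [AddCommGroup V] [Module ℂ V]
    (ρ : Representation ℂ G V) (f : G → ℂ) (v : V) : classOp ρ f v = ∑ g : G, f g • ρ g v := by
  simp [classOp]

theorem trace_classOp {G : Type} [Group G] [Fintype G] {V : Type} [AddCommGroup V] [Module ℂ V]
    (ρ : Representation ℂ G V) (f : G → ℂ) :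
    LinearMap.trace ℂ V (classOp ρ f) = ∑ g : G, f g * ρ.character g := by
  simp [classOp, Representation.character]

theorem classOp_comm {G : Type} [Group G] [Fintype G] {V : Type} [AddCommGroup V] [Module ℂ V]
    (ρ : Representation ℂ G V) (f : G → ℂ) (hf : ∀ g h, f (h * g * h⁻¹) = f g) (x : G) (v : V) :
    classOp ρ f (ρ x v) = ρ x (classOp ρ f v) := by
  rw [classOp_apply, classOp_apply, map_sum]
  refine (Fintype.sum_equiv (MulAut.conj x).toEquiv _ _ fun g => ?_).symm
  simp [hf, ← Module.End.mul_apply, ← map_mul]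

theorem classOp_schur {G : Type} [Group G] [Fintype G] {V : Type} [AddCommGroup V] [Module ℂ V]
    [FiniteDimensional ℂ V]
    (ρ : Representation ℂ G V) (hρ : ρ.IsIrreducible) (f : G → ℂ)
    (hf : ∀ g h, f (h * g * h⁻¹) = f g) : ∃ c : ℂ, ∀ v, classOp ρ f v = c • v := by
  let F : IntertwiningMap ρ ρ := ⟨classOp ρ f, fun g => by
    ext v; exact classOp_comm ρ f hf g v⟩
  obtain ⟨c, hc⟩ := (IsIrreducible.algebraMap_intertwiningMap_bijective_of_isAlgClosed
    (ρ := ρ)).2 F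
  refine ⟨c, fun v => ?_⟩
  have := congrArg (fun f : IntertwiningMap ρ ρ => f v) hc
  exact this.symm

theorem irred_nontrivial {G : Type} [Group G] {V : Type} [AddCommGroup V] [Module ℂ V]
    (ρ : Representation ℂ G V) (hρ : ρ.IsIrreducible) : Nontrivial V := by
  by_contra hV
  rw [not_nontrivial_iff_subsingleton] at hV
  exact (bot_ne_top (α := Subrepresentation ρ)) (Subrepresentation.toSubmodule_injective
    (Subsingleton.elim _ _))

theorem classOp_eq_zero {G : Type} [Group G] [Fintype G] {V : Type} [AddCommGroup V] [Module ℂ V]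
    [FiniteDimensional ℂ V]
    (ρ : Representation ℂ G V) (hρ : ρ.IsIrreducible) (f : G → ℂ)
    (hf : ∀ g h, f (h * g * h⁻¹) = f g) (h0 : ∑ g : G, f g * ρ.character g = 0) :
    classOp ρ f = 0 := by
  obtain ⟨c, hc⟩ := classOp_schur ρ hρ f hf
  have h1 : classOp ρ f = c • LinearMap.id := by ext v; simp [hc]
  have hnt := irred_nontrivial ρ hρ
  rw [← trace_classOp, h1, map_smul, LinearMap.trace_id] at h0
  have : (finrank ℂ V : ℂ) ≠ 0 := by
    exact_mod_cast (finrank_pos (R := ℂ) (M := V)).ne'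
  have hc0 : c = 0 := by simpa [this] using h0
  rw [h1, hc0, zero_smul]

theorem class_complete {G : Type} [Group G] [Fintype G] (f : G → ℂ)
    (hf : ∀ g h, f (h * g * h⁻¹) = f g)
    (h0 : ∀ (V : Type) [AddCommGroup V] [Module ℂ V] [FiniteDimensional ℂ V]
      (ρ : Representation ℂ G V), ρ.IsIrreducible → ∑ g : G, f g * ρ.character g = 0) :
    f = 0 := by
  let ρ : Representation ℂ G (G → ℂ) :=
    { toFun := fun x => LinearMap.funLeft ℂ ℂ (fun y => x⁻¹ * y)
      map_one' := by ext; simp [LinearMap.funLeft]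
      map_mul' := fun x y => by
        ext v z
        simp only [LinearMap.coe_comp, Function.comp_apply, Module.End.mul_apply,
          LinearMap.funLeft_apply, mul_inv_rev, mul_assoc] }
  let K : Subrepresentation ρ := ⟨LinearMap.ker (classOp ρ f), fun g v hv => by
    rw [LinearMap.mem_ker] at hv ⊢
    rw [classOp_comm ρ f hf, hv, map_zero]⟩
  obtain ⟨C, hC⟩ := exists_isCompl K
  have hCs : Subsingleton C.toSubmodule := by
    by_contra hCn
    rw [not_subsingleton_iff_nontrivial] at hCn
    obtain ⟨W, hW⟩ := exists_irred C.toRepresentation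
    obtain ⟨w, hw⟩ := @exists_ne _ (irred_nontrivial _ hW) (0 : W.toSubmodule)
    have h1 := congrArg (fun F => ((F w : W.toSubmodule) : C.toSubmodule)) (classOp_eq_zero _ hW f hf (h0 _ _ hW))
    have h2 : classOp ρ f ((w : C.toSubmodule) : G → ℂ) = 0 := by
      have h3 := congrArg (Subtype.val) h1
      simp only [classOp_apply] at h3 ⊢
      have h4 : ∑ x, f x • (((W.toRepresentation x w : W.toSubmodule) : C.toSubmodule) : G → ℂ) = 0 := by
        simpa using h3
      exact h4
    have h4 : ((w : C.toSubmodule) : G → ℂ) ∈ K ⊓ C := ⟨h2, (w : C.toSubmodule).2⟩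
    rw [hC.inf_eq_bot] at h4
    apply hw
    apply Subtype.ext
    apply Subtype.ext
    exact h4
  have hCb : C = ⊥ := Subrepresentation.toSubmodule_injective (Submodule.eq_bot_of_subsingleton)
  have hK : K = ⊤ := by
    have := hC.sup_eq_top
    rwa [hCb, sup_bot_eq] at this
  have h5 : (Pi.single 1 1 : G → ℂ) ∈ K := by rw [hK]; trivial
  have h6 : classOp ρ f (Pi.single 1 1 : G → ℂ) = 0 := h5
  rw [classOp_apply] at h6
  ext g
  have h7 := congrFun h6 g
  simpa [ρ, LinearMap.funLeft_apply, Pi.single_apply, inv_mul_eq_one] using h7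

theorem char_eq_iff {G : Type} [Group G] [Finite G] {V : Type} [AddCommGroup V] [Module ℂ V]
    [FiniteDimensional ℂ V]
    (ρ : Representation ℂ G V) (g : G) : ρ.character g = ρ.character 1 ↔ ρ g = 1 := by
  refine ⟨fun h => ?_, fun h => by simp [Representation.character, h]⟩
  set A : Module.End ℂ V := ρ g with hA
  obtain ⟨n, hn, hgn⟩ := (isOfFinOrder_of_finite g).exists_pow_eq_one
  have hAn : A ^ n = 1 := by rw [hA, ← map_pow, hgn, map_one]
  have hsp : A.charpoly.Splits := IsAlgClosed.splits _
  have htr := Module.End.trace_eq_sum_roots_charpoly_of_splits hsp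
  have hcard : A.charpoly.roots.card = finrank ℂ V := by
    rw [← LinearMap.charpoly_natDegree A]
    exact (Polynomial.splits_iff_card_roots.mp hsp)
  have hnorm : ∀ z ∈ A.charpoly.roots, ‖z‖ = 1 := by
    intro z hz
    have hev : A.HasEigenvalue z := (Module.End.hasEigenvalue_iff_isRoot_charpoly A z).mpr
      (Polynomial.isRoot_of_mem_roots hz)
    obtain ⟨v, hv⟩ := hev.exists_hasEigenvector
    have h1 := hv.pow_apply n
    rw [hAn, Module.End.one_apply] at h1
    have h2 : z ^ n = 1 := by
      have : (z ^ n - 1) • v = 0 := by rw [sub_smul, ← h1, one_smul, sub_self]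
      rcases smul_eq_zero.mp this with h | h
      · exact sub_eq_zero.mp h
      · exact absurd h hv.2
    exact Complex.norm_eq_one_of_pow_eq_one h2 (by omega)
  have hsum : (A.charpoly.roots.map (fun z : ℂ => 1 - z.re)).sum = 0 := by
    have h1 : A.charpoly.roots.sum = finrank ℂ V := by
      rw [← htr]; rw [char_one] at h; exact h
    have h2 : (A.charpoly.roots.map (fun z : ℂ => z.re)).sum = finrank ℂ V := by
      have := congrArg Complex.reAddGroupHom h1
      rw [map_multiset_sum] at this
      simpa using this
    rw [Multiset.sum_map_sub, h2]
    simp [hcard]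
  have hone : ∀ z ∈ A.charpoly.roots, z = 1 := by
    intro z hz
    have h3 : (1 - z.re) = 0 := by
      apply Multiset.all_zero_of_le_zero_le_of_sum_eq_zero _ hsum _ (Multiset.mem_map_of_mem _ hz)
      intro x hx
      obtain ⟨w, hw, rfl⟩ := Multiset.mem_map.mp hx
      have := Complex.re_le_norm w
      rw [hnorm w hw] at this
      linarith
    have h4 := hnorm z hz
    have h5 : z.re = 1 := by linarith
    have h6 : z.re ^ 2 + z.im ^ 2 = 1 := by
      have := Complex.sq_norm z
      rw [h4, Complex.normSq_apply] at this
      nlinarith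
    apply Complex.ext
    · simpa using h5
    · have : z.im ^ 2 = 0 := by nlinarith
      simpa using this
  have hcp : A.charpoly = (Polynomial.X - Polynomial.C 1) ^ (finrank ℂ V) := by
    have h1 := hsp.eq_prod_roots_of_monic (LinearMap.charpoly_monic A)
    rw [Multiset.eq_replicate_of_mem hone, hcard] at h1
    simpa using h1
  have hnil : (A - 1) ^ (finrank ℂ V) = 0 := by
    have := LinearMap.aeval_self_charpoly A
    rw [hcp] at this
    simpa using this
  have hss : A.IsSemisimple := by
    apply Module.End.isSemisimple_of_squarefree_aeval_eq_zero (p := Polynomial.X ^ n - 1)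
    · apply Polynomial.Separable.squarefree
      exact (Polynomial.separable_X_pow_sub_C (1 : ℂ) (by exact_mod_cast (by omega : n ≠ 0)) one_ne_zero)
    · simp [hAn]
  have hss2 : (A - 1 : Module.End ℂ V).IsSemisimple := by
    have := (Module.End.isSemisimple_sub_algebraMap_iff (f := A) (μ := (1:ℂ))).mpr hss
    simpa using this
  exact sub_eq_zero.mp (Module.End.eq_zero_of_isNilpotent_isSemisimple ⟨_, hnil⟩ hss2)

theorem sum_dite_mem {S : Type} [Group S] [Fintype S] (L : Subgroup S) (F : L → ℂ) :
    ∑ s : S, (if h : s ∈ L then F ⟨s, h⟩ else 0) = ∑ l : L, F l := by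
  rw [← Fintype.sum_subtype_add_sum_subtype (fun s => s ∈ L)]
  have h2 : ∑ i : {x // ¬ x ∈ L}, (if h : (i : S) ∈ L then F ⟨i, h⟩ else 0) = 0 :=
    Finset.sum_eq_zero fun i _ => dif_neg i.2
  rw [h2, add_zero]
  exact Finset.sum_congr (by ext; simp) fun i _ => dif_pos i.2

theorem inducedChar_eq {G : Type} [Group G] [Fintype G] (U : Subgroup G) (φ : U → ℂ) (g : G) :
    inducedChar U φ g = (Nat.card U : ℂ)⁻¹ *
      ∑ y : G, if h : y⁻¹ * g * y ∈ U then φ ⟨y⁻¹ * g * y, h⟩ else 0 := by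
  rw [inducedChar, finsum_eq_sum_of_fintype]

theorem inducedChar_conj {G : Type} [Group G] [Fintype G] (U : Subgroup G) (φ : U → ℂ) (g h : G) :
    inducedChar U φ (h * g * h⁻¹) = inducedChar U φ g := by
  rw [inducedChar_eq, inducedChar_eq]
  congr 1
  refine Fintype.sum_equiv (Equiv.mulLeft h⁻¹) _ _ fun y => ?_
  have : y⁻¹ * (h * g * h⁻¹) * y = ((Equiv.mulLeft h⁻¹) y)⁻¹ * g * ((Equiv.mulLeft h⁻¹) y) := by
    simp [mul_assoc]
  simp only [this]

theorem ind_frobenius {S : Type} [Group S] [Fintype S] (L : Subgroup S)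
    {V W : Type} [AddCommGroup V] [Module ℂ V] [FiniteDimensional ℂ V]
    [AddCommGroup W] [Module ℂ W] [FiniteDimensional ℂ W]
    (η : Representation ℂ S V) (σ : Representation ℂ L W) :
    ∑ s : S, inducedChar L σ.character s * η.character s⁻¹ =
      (Nat.card S : ℂ) * (finrank ℂ (IntertwiningMap (MonoidHom.comp η L.subtype : Representation ℂ L V) σ) : ℂ) := by
  simp only [inducedChar_eq, Finset.mul_sum, Finset.sum_mul]
  rw [Finset.sum_comm]
  have h1 : ∀ y : S, ∑ s : S, (Nat.card L : ℂ)⁻¹ *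
      (if h : y⁻¹ * s * y ∈ L then σ.character ⟨y⁻¹ * s * y, h⟩ else 0) * η.character s⁻¹ =
      (finrank ℂ (IntertwiningMap (MonoidHom.comp η L.subtype : Representation ℂ L V) σ) : ℂ) := by
    intro y
    have h2 : ∑ s : S, (Nat.card L : ℂ)⁻¹ *
        (if h : y⁻¹ * s * y ∈ L then σ.character ⟨y⁻¹ * s * y, h⟩ else 0) * η.character s⁻¹ =
        ∑ s : S, (Nat.card L : ℂ)⁻¹ *
        (if h : s ∈ L then σ.character ⟨s, h⟩ * η.character s⁻¹ else 0) := by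
      refine Fintype.sum_equiv (MulAut.conj y⁻¹).toEquiv _ _ fun s => ?_
      have h3 : (MulAut.conj y⁻¹).toEquiv s = y⁻¹ * s * y := by simp
      have h4 : η.character (y⁻¹ * s * y)⁻¹ = η.character s⁻¹ := by
        have := char_conj η s⁻¹ y⁻¹
        rw [← this]; congr 1; group
      rw [h3]
      by_cases h : y⁻¹ * s * y ∈ L
      · simp only [h, dif_pos, h4]; ring
      · simp only [h, dif_neg, not_false_eq_true]; ring
    rw [h2, ← Finset.mul_sum, sum_dite_mem L (fun l => σ.character l * η.character (l : S)⁻¹)]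
    have h5 := sum_char_eq (MonoidHom.comp η L.subtype : Representation ℂ L V) σ
    rw [inv_mul_eq_iff_eq_mul₀ (NeZero.ne (Nat.card L : ℂ)), ← h5]
    rfl
  rw [Finset.sum_congr rfl fun y _ => h1 y]
  simp [Nat.card_eq_fintype_card]

/-- Multiplicity number along a homomorphism. -/
def multAlong {S G : Type} [Group S] [Group G] (U : Subgroup G)
    {V W : Type} [AddCommGroup V] [Module ℂ V]
    [AddCommGroup W] [Module ℂ W]
    (η : Representation ℂ S V) (σ : Representation ℂ U W) (j : S →* G) : ℕ :=
  finrank ℂ (IntertwiningMap (MonoidHom.comp η (U.comap j).subtype : Representation ℂ (U.comap j) V)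
    (MonoidHom.comp σ (j.subgroupComap U) : Representation ℂ (U.comap j) W))

theorem sum_along {S G : Type} [Group S] [Fintype S] [Group G] (U : Subgroup G)
    {V W : Type} [AddCommGroup V] [Module ℂ V] [FiniteDimensional ℂ V]
    [AddCommGroup W] [Module ℂ W] [FiniteDimensional ℂ W]
    (η : Representation ℂ S V) (σ : Representation ℂ U W) (j : S →* G) :
    ∑ s : S, (if h : j s ∈ U then σ.character ⟨j s, h⟩ else 0) * η.character s⁻¹ =
      (Nat.card (U.comap j) : ℂ) * (multAlong U η σ j : ℂ) := by
  rw [multAlong, ← sum_char_eq]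
  have := sum_dite_mem (U.comap j)
    (fun l => σ.character (j.subgroupComap U l) * η.character (l : S)⁻¹)
  refine Eq.trans (Finset.sum_congr rfl fun s _ => ?_) (this.trans rfl)
  by_cases h : j s ∈ U
  · have h' : s ∈ U.comap j := h
    rw [dif_pos h, dif_pos h']; rfl
  · have h' : ¬ s ∈ U.comap j := h
    rw [dif_neg h, dif_neg h', zero_mul]

theorem multAlong_zero {S G : Type} [Group S] [Finite S] [Group G] [Finite G] (U : Subgroup G)
    {V W : Type} [AddCommGroup V] [Module ℂ V] [FiniteDimensional ℂ V]
    [AddCommGroup W] [Module ℂ W] [FiniteDimensional ℂ W]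
    (η : Representation ℂ S V) (σ : Representation ℂ U W) (j : S →* G)
    (h : ∑ᶠ s : S, inducedChar U σ.character (j s) * η.character s⁻¹ = 0) :
    multAlong U η σ j = 0 := by
  have : Fintype S := Fintype.ofFinite S
  have : Fintype G := Fintype.ofFinite G
  rw [finsum_eq_sum_of_fintype] at h
  simp only [inducedChar_eq, Finset.mul_sum, Finset.sum_mul] at h
  rw [Finset.sum_comm] at h
  let jy : G → (S →* G) := fun y => (MulAut.conj y⁻¹).toMonoidHom.comp j
  have hjy : ∀ y s, y⁻¹ * j s * y = jy y s := by intro y s; simp [jy]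
  simp only [hjy, mul_assoc] at h
  simp only [← Finset.mul_sum, sum_along] at h
  have h2 : ∑ y : G, Nat.card (U.comap (jy y)) * multAlong U η σ (jy y) = 0 := by
    have h3 := (mul_eq_zero.mp h).resolve_left (inv_ne_zero (NeZero.ne (Nat.card U : ℂ)))
    exact_mod_cast h3
  rw [Finset.sum_eq_zero_iff] at h2
  have h4 := h2 1 (Finset.mem_univ _)
  have h5 : jy 1 = j := by ext s; simp [jy]
  rw [h5] at h4
  exact (Nat.mul_eq_zero.mp h4).resolve_left Nat.card_pos.ne'

theorem lemmaA {S G : Type} [Group S] [Finite S] [Group G] [Finite G] (j : S →* G)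
    (ψ : G → ℂ) (hψ : IsQSI ψ)
    {X : Type} [AddCommGroup X] [Module ℂ X] [FiniteDimensional ℂ X]
    (τ : Representation ℂ S X) (hτ : τ.IsIrreducible)
    (hperp : ∀ (V : Type) [AddCommGroup V] [Module ℂ V] [FiniteDimensional ℂ V]
      (η : Representation ℂ S V), η.IsIrreducible → η.character ≠ τ.character →
      ∑ᶠ s : S, ψ (j s) * η.character s⁻¹ = 0) : IsQSI τ.character := by
  have : Fintype S := Fintype.ofFinite S
  obtain ⟨U, φ, hφ, ⟨k, hk, hkψ⟩, K, hKn, hK, hsol⟩ := hψ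
  obtain ⟨W, _, _, _, σ, hσ, rfl⟩ := bridge_to hφ
  have hWnt := irred_nontrivial σ hσ
  set L := U.comap j with hL
  let σL : Representation ℂ L W := MonoidHom.comp σ (j.subgroupComap U)
  obtain ⟨P, hP⟩ := exists_irred σL
  have hPnt := irred_nontrivial _ hP
  have horth : ∀ (V : Type) [AddCommGroup V] [Module ℂ V] [FiniteDimensional ℂ V]
      (η : Representation ℂ S V), η.IsIrreducible → η.character ≠ τ.character →
      finrank ℂ (IntertwiningMap (MonoidHom.comp η L.subtype : Representation ℂ L V)
        P.toRepresentation) = 0 := by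
    intro V _ _ _ η hη hne
    have h1 : multAlong U η σ j = 0 := by
      apply multAlong_zero
      have h2 := hperp V η hη hne
      rw [finsum_eq_sum_of_fintype] at h2 ⊢
      simp only [← hkψ, mul_assoc]
      rw [← Finset.mul_sum, h2, mul_zero]
    unfold multAlong at h1
    have hfin : FiniteDimensional ℂ (IntertwiningMap (MonoidHom.comp η L.subtype : Representation ℂ L V) σL) :=
      FiniteDimensional.of_injective
        (⟨⟨fun f => f.toLinearMap, fun _ _ => rfl⟩, fun _ _ => rfl⟩ :
          IntertwiningMap (MonoidHom.comp η L.subtype : Representation ℂ L V) σL →ₗ[ℂ] (V →ₗ[ℂ] W))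
        (IntertwiningMap.toLinearMap_injective _ _)
    have h3 : Subsingleton (IntertwiningMap (MonoidHom.comp η L.subtype : Representation ℂ L V) σL) :=
      Module.finrank_zero_iff.mp h1
    have h4 : Subsingleton (IntertwiningMap (MonoidHom.comp η L.subtype : Representation ℂ L V) P.toRepresentation) := by
      refine ⟨fun f g => ?_⟩
      let i : IntertwiningMap P.toRepresentation σL := ⟨P.toSubmodule.subtype, fun g => rfl⟩
      have h5 : i.comp f = i.comp g := Subsingleton.elim _ _
      apply IntertwiningMap.ext
      ext v
      exact congrArg (fun F : IntertwiningMap (MonoidHom.comp η L.subtype : Representation ℂ L V) σL => F v) h5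
    exact Module.finrank_zero_of_subsingleton
  set n := finrank ℂ (IntertwiningMap (MonoidHom.comp τ L.subtype : Representation ℂ L X)
        P.toRepresentation) with hn
  have hinv : Invertible (Nat.card S : ℂ) := invertibleOfNonzero (NeZero.ne (Nat.card S : ℂ))
  have hmain : (fun s : S => inducedChar L P.toRepresentation.character s⁻¹ - n * τ.character s⁻¹) = 0 := by
    apply class_complete
    · intro g h
      have h1 : (h * g * h⁻¹)⁻¹ = h * g⁻¹ * h⁻¹ := by group
      rw [h1, inducedChar_conj, char_conj]
    · intro V _ _ _ η hη
      have h1 : ∑ s : S, (inducedChar L P.toRepresentation.character s⁻¹ - n * τ.character s⁻¹) * η.character s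
          = ∑ s : S, inducedChar L P.toRepresentation.character s * η.character s⁻¹
            - n * ∑ s : S, τ.character s * η.character s⁻¹ := by
        rw [Finset.mul_sum, ← Finset.sum_sub_distrib]
        refine Fintype.sum_equiv (Equiv.inv S) _ _ fun s => ?_
        simp; ring
      rw [h1]
      by_cases hc : η.character = τ.character
      · rw [hc, ind_frobenius, sum_char_eq, IsIrreducible.finrank_intertwiningMap_self τ]
        simp only [← hn]
        push_cast; ring
      · have h2 := char_orthonormal τ η
        rw [if_neg] at h2
        · have h3 := (mul_eq_zero.mp h2).resolve_left (inv_ne_zero (NeZero.ne (Nat.card S : ℂ)))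
          rw [h3, ind_frobenius, horth V η hη hc]
          simp
        · rintro ⟨e⟩
          exact hc (char_iso e)
  have hmain2 : ∀ s, (n : ℂ) * τ.character s = inducedChar L P.toRepresentation.character s := by
    intro s
    have := congrFun hmain s⁻¹
    simp only [inv_inv, Pi.zero_apply] at this
    exact (sub_eq_zero.mp this).symm
  refine ⟨L, P.toRepresentation.character, bridge_of _ hP, ⟨n, ?_, hmain2⟩, ?_⟩
  · rcases Nat.eq_zero_or_pos n with h0 | h0
    · exfalso
      have h1 := hmain2 1
      rw [h0, Nat.cast_zero, zero_mul, inducedChar_eq] at h1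
      have h2 : ∀ y : S, (if h : y⁻¹ * 1 * y ∈ L then P.toRepresentation.character ⟨y⁻¹ * 1 * y, h⟩ else 0)
          = (finrank ℂ P.toSubmodule : ℂ) := by
        intro y
        have h3 : y⁻¹ * 1 * y = 1 := by group
        simp only [h3, L.one_mem, dif_pos]
        exact char_one _
      simp only [h2, Finset.sum_const, Finset.card_univ] at h1
      have hpos : (finrank ℂ P.toSubmodule : ℂ) ≠ 0 := by
        exact_mod_cast (finrank_pos (R := ℂ) (M := P.toSubmodule)).ne'
      have hS0 : (Fintype.card S : ℂ) ≠ 0 := by exact_mod_cast Fintype.card_ne_zero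
      have hL0 := NeZero.ne (Nat.card L : ℂ)
      rw [nsmul_eq_mul] at h1
      exact (mul_ne_zero (inv_ne_zero hL0) (mul_ne_zero hS0 hpos)) h1.symm
    · exact h0
  · refine ⟨MonoidHom.ker P.toRepresentation, inferInstance, ?_, ?_⟩
    · ext l
      simp only [SetLike.mem_coe, MonoidHom.mem_ker, Set.mem_ofPred_eq]
      exact (char_eq_iff P.toRepresentation l).symm
    · have hKker : ∀ u ∈ K, σ u = 1 := by
        intro u hu
        have : u ∈ (K : Set U) := hu
        rw [hK] at this
        exact (char_eq_iff σ u).mp this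
      let q : L →* U ⧸ K := (QuotientGroup.mk' K).comp (j.subgroupComap U)
      have hq : q.ker ≤ MonoidHom.ker P.toRepresentation := by
        intro l hl
        have h1 : j.subgroupComap U l ∈ K := by
          rw [MonoidHom.mem_ker] at hl
          exact (QuotientGroup.eq_one_iff _).mp hl
        have h2 := hKker _ h1
        rw [MonoidHom.mem_ker]
        ext v
        exact congrArg (fun F : W →ₗ[ℂ] W => F v) h2
      have hs0 : Group.IsSolvable (U ⧸ K) := hsol
      have hs1 : Group.IsSolvable q.range :=
        Group.isSolvable_of_isSolvable_injective q.range.subtype_injective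
      have hs2 : Group.IsSolvable (L ⧸ q.ker) :=
        Group.isSolvable_of_surjective (f := (QuotientGroup.quotientKerEquivRange q).symm.toMonoidHom)
          (QuotientGroup.quotientKerEquivRange q).symm.surjective
      exact Group.isSolvable_of_surjective (f := QuotientGroup.map q.ker (MonoidHom.ker P.toRepresentation)
        (MonoidHom.id L) hq) (by
          intro x
          induction x using QuotientGroup.induction_on with
          | H z => exact ⟨(z : L ⧸ q.ker), rfl⟩)

theorem center_triv {S : Type} [Group S] (hS : IsSimpleGroup S)
    (hnonab : ¬ ∀ a b : S, a * b = b * a) (x : S) (hx : ∀ t, t * x = x * t) : x = 1 := by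
  rcases (Subgroup.Normal.eq_bot_or_eq_top (inferInstance : (Subgroup.center S).Normal)) with h | h
  · have : x ∈ Subgroup.center S := Subgroup.mem_center_iff.mpr hx
    rw [h] at this
    exact this
  · exfalso
    apply hnonab
    intro a b
    have : b ∈ Subgroup.center S := by rw [h]; trivial
    exact Subgroup.mem_center_iff.mp this a

theorem aut_factor {S : Type} [Group S] [Finite S] (hS : IsSimpleGroup S)
    (hnonab : ¬ ∀ a b : S, a * b = b * a) {m : ℕ} (β : MulAut (Fin m → S)) (i : Fin m) :
    ∃ (k : Fin m) (α : MulAut S), ∀ s, β (Pi.mulSingle i s) = Pi.mulSingle k (α s) := by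
  obtain ⟨t, ht⟩ := exists_ne (1 : S)
  have hx : β (Pi.mulSingle i t) ≠ 1 := by
    intro h
    rw [map_eq_one_iff β β.injective, Pi.mulSingle_eq_one_iff] at h
    exact ht h
  obtain ⟨k, hk⟩ := Function.ne_iff.mp hx
  let R : Fin m → Subgroup (Fin m → S) := fun i => (MonoidHom.mulSingle (fun _ => S) i).range
  have hRn : ∀ i, (R i).Normal := by
    intro i
    refine ⟨?_⟩
    rintro _ ⟨s, rfl⟩ g
    refine ⟨g i * s * (g i)⁻¹, ?_⟩
    ext l
    by_cases hl : l = i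
    · subst hl; simp
    · simp [hl]
  let M : Subgroup (Fin m → S) := (R i).map β.toMonoidHom
  have hMn : M.Normal := (hRn i).map _ β.surjective
  let x := β (Pi.mulSingle i t)
  have hxM : x ∈ M := ⟨Pi.mulSingle i t, ⟨t, rfl⟩, rfl⟩
  have hD : (M.comap (MonoidHom.mulSingle (fun _ => S) k)) = ⊤ := by
    have hDn : (M.comap (MonoidHom.mulSingle (fun _ => S) k)).Normal := inferInstance
    refine hDn.eq_bot_or_eq_top.resolve_left fun hbot => hk ?_
    apply center_triv hS hnonab
    intro u
    have hmem : u * x k * u⁻¹ * (x k)⁻¹ ∈ M.comap (MonoidHom.mulSingle (fun _ => S) k) := by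
      rw [Subgroup.mem_comap]
      have h1 : (MonoidHom.mulSingle (fun _ => S) k) (u * x k * u⁻¹ * (x k)⁻¹) =
          (Pi.mulSingle k u : Fin m → S) * x * (Pi.mulSingle k u : Fin m → S)⁻¹ * x⁻¹ := by
        ext l
        by_cases hl : l = k
        · subst hl; simp
        · simp [hl]
      rw [h1]
      exact M.mul_mem (hMn.conj_mem x hxM _) (M.inv_mem hxM)
    rw [hbot, Subgroup.mem_bot, mul_inv_eq_one, mul_inv_eq_iff_eq_mul] at hmem
    exact hmem
  have hle : R k ≤ M := by
    rintro _ ⟨s, rfl⟩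
    have : s ∈ (M.comap (MonoidHom.mulSingle (fun _ => S) k)) := by rw [hD]; trivial
    exact this
  have hcardR : ∀ i, Nat.card (R i) = Nat.card S := fun i =>
    (Nat.card_congr (MonoidHom.ofInjective (Pi.mulSingle_injective (M := fun _ : Fin m => S) i)).toEquiv).symm
  have hcardM : Nat.card M = Nat.card S := by
    rw [← hcardR i]
    exact (Nat.card_congr (Subgroup.equivMapOfInjective (R i) β.toMonoidHom β.injective).toEquiv).symm
  have hEq : R k = M := Subgroup.eq_of_le_of_card_ge hle (by rw [hcardR, hcardM])
  let a : S →* S := (Pi.evalMonoidHom (fun _ => S) k).comp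
    (β.toMonoidHom.comp (MonoidHom.mulSingle (fun _ => S) i))
  have ha : ∀ s, β (Pi.mulSingle i s) = Pi.mulSingle k (a s) := by
    intro s
    have h1 : β (Pi.mulSingle i s) ∈ R k := by
      rw [hEq]; exact ⟨Pi.mulSingle i s, ⟨s, rfl⟩, rfl⟩
    obtain ⟨u, hu⟩ := h1
    have h2 : a s = u := by
      change β (Pi.mulSingle i s) k = u
      rw [← hu]; simp
    rw [h2, ← hu]; rfl
  have hinj : Function.Injective a := by
    intro s s' h
    apply Pi.mulSingle_injective (M := fun _ : Fin m => S) i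
    apply β.injective
    rw [ha, ha, h]
  exact ⟨k, MulEquiv.ofBijective a (Finite.injective_iff_bijective.mp hinj), ha⟩

theorem theta_inv {S : Type} [Group S] [Finite S] (hS : IsSimpleGroup S)
    (hnonab : ¬ ∀ a b : S, a * b = b * a) {m : ℕ} (β : MulAut (Fin m → S))
    (χ : S → ℂ) (hinv : ∀ (α : MulAut S) (s : S), χ (α s) = χ s) (s : Fin m → S) :
    ∏ i, χ ((β s) i) = ∏ i, χ (s i) := by
  choose σ α hα using aut_factor hS hnonab β
  have hσ : Function.Injective σ := by
    intro i i' h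
    by_contra hne
    apply hnonab
    intro a b
    have h1 : β (Pi.mulSingle i ((α i).symm a)) * β (Pi.mulSingle i' ((α i').symm b)) =
        β (Pi.mulSingle i' ((α i').symm b)) * β (Pi.mulSingle i ((α i).symm a)) := by
      rw [← map_mul, ← map_mul]
      congr 1
      exact Pi.mulSingle_commute (f := fun _ : Fin m => S) hne _ _
    rw [hα, hα, h] at h1
    simpa using congrFun h1 (σ i')
  have key : ∀ i, (β s) (σ i) = α i (s i) := by
    intro i
    have h1 : s = Function.update s i 1 * Pi.mulSingle i (s i) := by
      ext l
      by_cases hl : l = i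
      · subst hl; simp
      · simp [hl]
    have h2 : β (Function.update s i 1) (σ i) = 1 := by
      apply center_triv hS hnonab
      intro t
      have h3 : β (Pi.mulSingle i ((α i).symm t)) * β (Function.update s i 1) =
          β (Function.update s i 1) * β (Pi.mulSingle i ((α i).symm t)) := by
        rw [← map_mul, ← map_mul]
        congr 1
        ext l
        by_cases hl : l = i
        · subst hl; simp
        · simp [hl]
      rw [hα] at h3
      simpa using congrFun h3 (σ i)
    conv_lhs => rw [h1, map_mul, hα]
    simp [h2]
  have hbij : Function.Bijective σ := Finite.injective_iff_bijective.mp hσ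
  rw [← hbij.prod_comp (fun k => χ ((β s) k))]
  exact Finset.prod_congr rfl fun i _ => by rw [key, hinv]

theorem lemmaB (G : Type) [Group G] [Finite G]
    (S : Type) [Group S] [Finite S]
    (hS : IsSimpleGroup S) (hnonab : ¬ ∀ a b : S, a * b = b * a)
    (n : ℕ) (N : Subgroup G) [N.Normal] (e : ↥N ≃* (Fin (n + 1) → S))
    {X : Type} [AddCommGroup X] [Module ℂ X] [FiniteDimensional ℂ X]
    (τ : Representation ℂ S X) (hτ : τ.IsIrreducible)
    (hinv : ∀ (α : MulAut S) (s : S), τ.character (α s) = τ.character s) :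
    ∃ (V : Type) (_ : AddCommGroup V) (_ : Module ℂ V) (_ : FiniteDimensional ℂ V)
      (ρ : Representation ℂ G V) (j : S →* G), ρ.IsIrreducible ∧
      ∀ (Y : Type) [AddCommGroup Y] [Module ℂ Y] [FiniteDimensional ℂ Y]
      (η : Representation ℂ S Y), η.IsIrreducible → η.character ≠ τ.character →
      ∑ᶠ s : S, ρ.character (j s) * η.character s⁻¹ = 0 := by
  have : Fintype S := Fintype.ofFinite S
  have : Fintype G := Fintype.ofFinite G
  let χ' : S → ℂ := fun s => τ.character s⁻¹
  have hχ'inv : ∀ (α : MulAut S) (s : S), χ' (α s) = χ' s := by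
    intro α s
    simp only [χ', ← map_inv, hinv]
  let f : G → ℂ := fun g => if h : g ∈ N then ∏ i, χ' (e ⟨g, h⟩ i) else 0
  have hf : ∀ g h, f (h * g * h⁻¹) = f g := by
    intro g h
    by_cases hg : g ∈ N
    · have hg' : h * g * h⁻¹ ∈ N := (inferInstance : N.Normal).conj_mem g hg h
      simp only [f, dif_pos hg, dif_pos hg']
      let β : MulAut (Fin (n + 1) → S) := (e.symm.trans (MulAut.conjNormal h)).trans e
      rw [← theta_inv hS hnonab β χ' hχ'inv (e ⟨g, hg⟩)]
      have : β (e ⟨g, hg⟩) = e ⟨h * g * h⁻¹, hg'⟩ := by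
        simp only [β, MulEquiv.trans_apply, MulEquiv.symm_apply_apply]
        congr 1
      rw [this]
    · have hg' : ¬ h * g * h⁻¹ ∈ N := by
        intro h'
        have h2 := (inferInstance : N.Normal).conj_mem _ h' h⁻¹
        have h3 : h⁻¹ * (h * g * h⁻¹) * h⁻¹⁻¹ = g := by group
        rw [h3] at h2
        exact hg h2
      simp only [f, dif_neg hg, dif_neg hg']
  have hf0 : f ≠ 0 := by
    intro h0
    have h1 := congrFun h0 1
    have hnt := irred_nontrivial τ hτ
    have h2 : (finrank ℂ X : ℂ) ≠ 0 := by
      exact_mod_cast (finrank_pos (R := ℂ) (M := X)).ne'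
    have h3 : e ⟨1, N.one_mem⟩ = 1 := map_one e
    simp only [f, dif_pos N.one_mem, h3, χ', Pi.one_apply, inv_one, char_one, Pi.zero_apply] at h1
    exact Finset.prod_ne_zero_iff.mpr (fun _ _ => h2) h1
  have hex : ∃ (V : Type) (_ : AddCommGroup V) (_ : Module ℂ V) (_ : FiniteDimensional ℂ V)
      (ρ : Representation ℂ G V), ρ.IsIrreducible ∧ ∑ g : G, f g * ρ.character g ≠ 0 := by
    by_contra hcon
    push Not at hcon
    exact hf0 (class_complete f hf fun V _ _ _ ρ hρ => hcon V _ _ inferInstance ρ hρ)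
  obtain ⟨V, _, _, _, ρ, hρ, hne⟩ := hex
  obtain ⟨c, hc⟩ := classOp_schur ρ hρ f hf
  have hc0 : c ≠ 0 := by
    rintro rfl
    apply hne
    have : classOp ρ f = 0 := by ext v; simp [hc]
    rw [← trace_classOp, this, map_zero]
  let ι : (Fin (n + 1) → S) →* G := N.subtype.comp e.symm.toMonoidHom
  let j : S →* G := ι.comp (MonoidHom.mulSingle (fun _ => S) 0)
  refine ⟨V, _, _, inferInstance, ρ, j, hρ, ?_⟩
  intro Y _ _ _ η hη hneq
  have hinvt : Invertible (Nat.card S : ℂ) := invertibleOfNonzero (NeZero.ne (Nat.card S : ℂ))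
  have hE : classOp η χ' = 0 := by
    apply classOp_eq_zero η hη χ'
    · intro g h
      have h1 : (h * g * h⁻¹)⁻¹ = h * g⁻¹ * h⁻¹ := by group
      simp only [χ', h1, char_conj]
    · have h2 := char_orthonormal η τ
      rw [if_neg (by rintro ⟨e⟩; exact hneq (char_iso e).symm)] at h2
      have h3 := (mul_eq_zero.mp h2).resolve_left (inv_ne_zero (NeZero.ne (Nat.card S : ℂ)))
      simpa only [χ', mul_comm] using h3
  have hsplit : ∀ v : V, classOp ρ f v = ∑ b : Fin n → S,
      (∏ i, χ' (b i)) • ρ (ι (Fin.cons 1 b)) (∑ a : S, χ' a • ρ (j a) v) := by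
    intro v
    have h1 : classOp ρ f v = ∑ s : Fin (n + 1) → S, (∏ i, χ' (s i)) • ρ (ι s) v := by
      rw [classOp_apply, ← Fintype.sum_subtype_add_sum_subtype (fun g => g ∈ N)]
      have h2 : ∑ g : {x // ¬ x ∈ N}, f g • ρ g v = 0 :=
        Finset.sum_eq_zero fun g _ => by simp only [f, dif_neg g.2, zero_smul]
      rw [h2, add_zero]
      refine Fintype.sum_equiv e.toEquiv _ _ fun g => ?_
      have hg : (g : G) ∈ N := g.2
      simp only [f, dif_pos hg]
      congr 2
      simp [ι]
    rw [h1, ← (Fin.consEquiv (fun _ : Fin (n + 1) => S)).sum_comp, Fintype.sum_prod_type,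
      Finset.sum_comm]
    refine Finset.sum_congr rfl fun b _ => ?_
    rw [map_sum, Finset.smul_sum]
    refine Finset.sum_congr rfl fun a _ => ?_
    have h3 : (Fin.cons a b : Fin (n + 1) → S) = Fin.cons 1 b * Pi.mulSingle 0 a := by
      ext l
      refine Fin.cases ?_ (fun l => ?_) l
      · simp
      · simp
    have h4 : ρ (ι (Fin.cons a b)) v = ρ (ι (Fin.cons 1 b)) (ρ (j a) v) := by
      rw [h3, map_mul, map_mul]; rfl
    rw [map_smul, smul_smul, ← h4]
    change (∏ i, χ' ((Fin.cons a b : Fin (n + 1) → S) i)) • ρ (ι (Fin.cons a b)) v = _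
    rw [Fin.prod_univ_succ]
    simp [mul_comm]
  have hsub : Subsingleton (IntertwiningMap η (MonoidHom.comp ρ j : Representation ℂ S V)) := by
    have hz : ∀ (F : IntertwiningMap η (MonoidHom.comp ρ j : Representation ℂ S V)), F = 0 := by
      intro F
      apply IntertwiningMap.ext
      ext v
      have h1 := hc (F v)
      rw [hsplit] at h1
      have h2 : ∑ a : S, χ' a • ρ (j a) (F v) = 0 := by
        have h3 : ∀ a, ρ (j a) (F v) = F (η a v) := fun a =>
          (IntertwiningMap.isIntertwining η (MonoidHom.comp ρ j : Representation ℂ S V) F a v).symm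
        have h4 : F (classOp η χ' v) = 0 := by rw [hE]; simp
        rw [classOp_apply, map_sum] at h4
        rw [← h4]
        exact Finset.sum_congr rfl fun a _ => by rw [h3, map_smul]
      simp only [h2, map_zero, smul_zero, Finset.sum_const_zero] at h1
      exact (smul_eq_zero.mp h1.symm).resolve_left hc0
    exact ⟨fun F F' => by rw [hz F, hz F']⟩
  rw [finsum_eq_sum_of_fintype]
  have h5 := sum_char_eq η (MonoidHom.comp ρ j : Representation ℂ S V)
  rw [Module.finrank_zero_of_subsingleton, Nat.cast_zero, mul_zero] at h5
  exact h5

end helpers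

/-- Let `S` be a non-abelian finite simple group, `m ≥ 1`, and let `G` be a finite QSI group
containing `N ≅ S^m` as a normal subgroup with trivial centralizer (so `S^m ≤ G ≤ Aut(S^m)`).
Then every `Aut(S)`-invariant irreducible character of `S` is QSI as a character of `S`. -/
theorem aut_invariant_char_isQSI (G : Type) [Group G] [Finite G] (hG : IsQSIGroup G)
    (S : Type) [Group S] [Finite S]
    (hS : IsSimpleGroup S) (hnonab : ¬ ∀ a b : S, a * b = b * a)
    (m : ℕ) (hm : 1 ≤ m)
    (N : Subgroup G) [N.Normal]
    (hiso : Nonempty (↥N ≃* (Fin m → S)))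
    (hcent : Subgroup.centralizer (N : Set G) = ⊥)
    (χ : S → ℂ) (hχirr : IsIrreducibleCharacter S χ)
    (hinv : ∀ (α : MulAut S) (s : S), χ (α s) = χ s) :
    IsQSI χ := by
  obtain ⟨n, rfl⟩ : ∃ n, m = n + 1 := ⟨m - 1, by omega⟩
  obtain ⟨e⟩ := hiso
  obtain ⟨X, _, _, _, τ, hτ, rfl⟩ := bridge_to hχirr
  obtain ⟨V, _, _, _, ρ, j, hρ, hperp⟩ := lemmaB G S hS hnonab n N e τ hτ hinv
  exact lemmaA j ρ.character (hG _ (bridge_of ρ hρ)) τ hτ hperp
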